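/- Let X be a standard Borel space, let κ be a Markov kernel from X to X, and for x ∈ X let P_x denote the law (given by the Ionescu–Tulcea construction) of the time-homogeneous Markov chain (X_n)_{n≥0} on the path space ℕ → X with X_0 = x and one-step transitions κ. For a measurable set w ⊆ X, let τ_w = inf{n ≥ 1 : X_n ∉ w} be the first exit time from w. Let x₀, x₁ ∈ X, let T, t* ∈ ℕ with t* < T, let δ ∈ [0,1) and ε ≥ 0, and suppose: (i) P_{x₀}(τ_w < T) ≤ δ and P_{x₁}(τ_w < T) ≤ δ; and (ii) there exists a probability measure π on X such that for i = 0,1, TV((law of X_{t*} under P_{x_i} conditioned on the event {τ_w > t*}), π) ≤ ε. Then for every measurable classifier g : X → {0,1}, (1/2)·P_{x₀}({g(X_{t*}) = 1}) + (1/2)·P_{x₁}({g(X_{t*}) = 0}) ≥ (1 − δ)·(1/2 − ε). -/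

import Mathlib

open MeasureTheory ProbabilityTheory

/-- Total variation distance between two measures:
`TV(μ, ν) = sup_{A measurable} |μ(A) − ν(A)|`. -/
noncomputable def tv {X : Type*} [MeasurableSpace X] (μ ν : Measure X) : ℝ :=
  ⨆ A : {A : Set X // MeasurableSet A}, |(μ A.1).toReal - (ν A.1).toReal|

/-- First exit time `τ_w = inf {n ≥ 1 : ω n ∉ w}` of a path `ω : ℕ → X` from a set `w`,
valued in `ℕ∞` (so that it is `⊤` if the path never exits). -/
noncomputable def exitTime {X : Type*} (w : Set X) (ω : ℕ → X) : ℕ∞ :=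
  sInf ((fun n : ℕ => (n : ℕ∞)) '' {n : ℕ | 1 ≤ n ∧ ω n ∉ w})

lemma abs_sub_le_tv {X : Type*} [MeasurableSpace X] (μ ν : Measure X)
    [IsFiniteMeasure μ] [IsFiniteMeasure ν] {A : Set X} (hA : MeasurableSet A) :
    |μ.real A - ν.real A| ≤ tv μ ν := by
  have hbdd : BddAbove (Set.range fun A : {A : Set X // MeasurableSet A} =>
      |(μ A.1).toReal - (ν A.1).toReal|) := by
    refine ⟨μ.real Set.univ + ν.real Set.univ, ?_⟩
    rintro _ ⟨B, rfl⟩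
    have hμ : μ.real B.1 ≤ μ.real Set.univ := measureReal_mono (Set.subset_univ _)
    have hν : ν.real B.1 ≤ ν.real Set.univ := measureReal_mono (Set.subset_univ _)
    have hμ0 : 0 ≤ μ.real B.1 := measureReal_nonneg
    have hν0 : 0 ≤ ν.real B.1 := measureReal_nonneg
    change |μ.real B.1 - ν.real B.1| ≤ _
    rw [abs_le]
    constructor <;> linarith
  exact le_ciSup hbdd ⟨A, hA⟩

lemma natCast_lt_exitTime_iff {X : Type*} (w : Set X) (ω : ℕ → X) (t : ℕ) :
    (t : ℕ∞) < exitTime w ω ↔ ∀ n, 1 ≤ n → n ≤ t → ω n ∈ w := by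
  rw [← not_le, exitTime]
  constructor
  · intro h n h1 hn
    by_contra hw
    have hle : sInf ((fun n : ℕ => (n : ℕ∞)) '' {n : ℕ | 1 ≤ n ∧ ω n ∉ w}) ≤ (n : ℕ∞) :=
      sInf_le ⟨n, ⟨h1, hw⟩, rfl⟩
    exact h (hle.trans (by exact_mod_cast hn))
  · intro h hle
    have hlt := hle.trans_lt (show (t : ℕ∞) < ((t + 1 : ℕ) : ℕ∞) by
      exact_mod_cast Nat.lt_succ_self t)
    obtain ⟨_, ⟨n, ⟨h1, hw⟩, rfl⟩, hn⟩ := sInf_lt_iff.1 hlt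
    have hn' : n < t + 1 := Nat.cast_lt.1 hn
    exact hw (h n h1 (by omega))

lemma measurableSet_natCast_lt_exitTime {X : Type*} [MeasurableSpace X] {w : Set X}
    (hw : MeasurableSet w) (t : ℕ) :
    MeasurableSet {ω : ℕ → X | (t : ℕ∞) < exitTime w ω} := by
  simp only [natCast_lt_exitTime_iff, Set.ofPred_forall]
  exact .iInter fun n => .iInter fun _ => .iInter fun _ => measurable_pi_apply n hw

/-- A path law that survives in `w` up to time `T` with probability at least `1 - δ`, and whose
time-`t` marginal conditioned on survival is `ε`-close to `π`, charges every measurable set at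
time `t` with mass at least `(1 - δ) * (π A - ε)`. -/
lemma mul_sub_le_measure_of_tv_cond_le {X : Type*} [MeasurableSpace X]
    (μ : Measure (ℕ → X)) [IsProbabilityMeasure μ] {w : Set X} (hw : MeasurableSet w)
    {T t : ℕ} (ht : t < T) {δ ε : ℝ} (hδ : δ < 1)
    (hexit : (μ {ω | exitTime w ω < (T : ℕ∞)}).toReal ≤ δ)
    (π : Measure X) [IsProbabilityMeasure π]
    (hmix : tv ((μ[|{ω | (t : ℕ∞) < exitTime w ω}]).map (fun ω => ω t)) π ≤ ε)
    {A : Set X} (hA : MeasurableSet A) :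
    (1 - δ) * ((π A).toReal - ε) ≤ (μ {ω | ω t ∈ A}).toReal := by
  set E : Set (ℕ → X) := {ω | (t : ℕ∞) < exitTime w ω}
  have hEm : MeasurableSet E := measurableSet_natCast_lt_exitTime hw t
  have hcompl : μ.real Eᶜ ≤ δ := by
    refine (measureReal_mono (fun ω hω => ?_)).trans hexit
    have hle : exitTime w ω ≤ t := not_lt.1 hω
    exact hle.trans_lt (by exact_mod_cast ht)
  have hEδ : 1 - δ ≤ μ.real E := by
    have := probReal_compl_eq_one_sub (μ := μ) hEm
    linarith
  have hmeas : Measurable fun ω : ℕ → X => ω t := measurable_pi_apply t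
  have hclose : |((μ[|E]).map fun ω => ω t).real A - π.real A| ≤ ε :=
    le_trans (abs_sub_le_tv _ π hA) hmix
  rw [map_measureReal_apply hmeas hA] at hclose
  have hlower := (abs_le.1 hclose).1
  have hmul : (μ[|E]).real {ω | ω t ∈ A} * μ.real E = μ.real (E ∩ {ω | ω t ∈ A}) := by
    simpa [measureReal_def] using congrArg ENNReal.toReal
      (cond_mul_eq_inter hEm {ω | ω t ∈ A} μ)
  have hinter : μ.real (E ∩ {ω | ω t ∈ A}) ≤ μ.real {ω | ω t ∈ A} :=
    measureReal_mono Set.inter_subset_right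
  have hnonneg : 0 ≤ (μ[|E]).real {ω | ω t ∈ A} := measureReal_nonneg
  have hcond : (π A).toReal - ε ≤ (μ[|E]).real {ω | ω t ∈ A} := by
    have h : -ε ≤ (μ[|E]).real {ω | ω t ∈ A} - (π A).toReal := hlower
    linarith
  calc (1 - δ) * ((π A).toReal - ε) ≤ (1 - δ) * (μ[|E]).real {ω | ω t ∈ A} :=
        mul_le_mul_of_nonneg_left hcond (by linarith)
    _ ≤ μ.real E * (μ[|E]).real {ω | ω t ∈ A} := mul_le_mul_of_nonneg_right hEδ hnonneg
    _ ≤ μ.real {ω | ω t ∈ A} := by linarith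

/-- Part 1 of the Basin Identifiability theorem. `X` is a standard Borel space, `κ` a
Markov kernel on `X`, and `P` the family of laws of the time-homogeneous Markov chain
with transition kernel `κ` on path space `ℕ → X`; the Ionescu–Tulcea law is characterized
by: `P x`-a.s. the path starts at `x`, and the law of the shifted path
`n ↦ ω (n+1)` under `P x` is `∫ P y ∂κ(x, ·)`. If trajectories from `x₀` and `x₁`
exit the well `w` before time `T` with probability at most `δ`, and the laws of
`X_{t*}` conditioned on `{τ_w > t*}` are within `ε` in total variation of a common
quasi-stationary distribution `π`, then every measurable classifier `g : X → {0,1}`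
(here `Bool`) has balanced risk at least `(1 − δ)·(1/2 − ε)`. -/
theorem stmt_6 {X : Type*} [MeasurableSpace X] [StandardBorelSpace X]
    (κ : Kernel X X) [IsMarkovKernel κ]
    (P : Kernel X (ℕ → X)) [IsMarkovKernel P]
    (hstart : ∀ x : X, P x {ω | ω 0 = x} = 1)
    (hshift : ∀ x : X, (P x).map (fun ω n => ω (n + 1)) = (κ x).bind (fun y => P y))
    (w : Set X) (hw : MeasurableSet w)
    (x₀ x₁ : X) (T tstar : ℕ) (ht : tstar < T)
    (δ ε : ℝ) (hδ0 : 0 ≤ δ) (hδ1 : δ < 1) (hε : 0 ≤ ε)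
    (hexit0 : (P x₀ {ω | exitTime w ω < (T : ℕ∞)}).toReal ≤ δ)
    (hexit1 : (P x₁ {ω | exitTime w ω < (T : ℕ∞)}).toReal ≤ δ)
    (π : Measure X) [IsProbabilityMeasure π]
    (hmix0 :
      tv (((P x₀)[|{ω | (tstar : ℕ∞) < exitTime w ω}]).map (fun ω => ω tstar)) π ≤ ε)
    (hmix1 :
      tv (((P x₁)[|{ω | (tstar : ℕ∞) < exitTime w ω}]).map (fun ω => ω tstar)) π ≤ ε)
    (g : X → Bool) (hg : Measurable g) :
    (1 - δ) * (1 / 2 - ε) ≤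
      (1 / 2) * (P x₀ {ω | g (ω tstar) = true}).toReal
        + (1 / 2) * (P x₁ {ω | g (ω tstar) = false}).toReal := by
  have hA : MeasurableSet {x | g x = true} := hg (measurableSet_singleton true)
  have h0 := mul_sub_le_measure_of_tv_cond_le (P x₀) hw ht hδ1 hexit0 π hmix0 hA
  have h1 := mul_sub_le_measure_of_tv_cond_le (P x₁) hw ht hδ1 hexit1 π hmix1
    (A := {x | g x = false}) (hg (measurableSet_singleton false))
  have hcompl : {x | g x = false} = {x | g x = true}ᶜ := by
    ext x
    simp
  have hsum : (π {x | g x = false}).toReal = 1 - (π {x | g x = true}).toReal := by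
    rw [hcompl]
    exact probReal_compl_eq_one_sub hA
  rw [hsum] at h1
  simp only [Set.mem_ofPred_eq] at h0 h1
  linarith
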